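/- For every d ∈ (0,1) and every λ > 0, the capacity of the binary deletion channel and the capacity of the Poisson repeat channel satisfy C(BDC_d) ≥ ((1−d)/λ)·C(PRC_λ). Formally: for all reals L and L_P, if C_n(d)/n → L and C_n^{PRC}(λ)/n → L_P as n → ∞, then L ≥ ((1−d)/λ)·L_P. -/

import Mathlib

open Finset

/-- Mutual information of a joint distribution `q` on `α × List Bool`, with a
countable output alphabet: `I(X;Y) = Σ_{x,y} q x y · log₂(q x y / (Pr[X=x]·Pr[Y=y]))`,
where terms with `q x y = 0` vanish. -/
noncomputable def MIc {α : Type*} [Fintype α] (q : α → List Bool → ℝ) : ℝ :=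
  ∑ x : α, ∑' y : List Bool, q x y *
    Real.logb 2 (q x y / ((∑' y' : List Bool, q x y') * (∑ x' : α, q x' y)))

/-- `p` is a probability distribution on the finite type `α`. -/
def IsDist {α : Type*} [Fintype α] (p : α → ℝ) : Prop :=
  (∀ a, 0 ≤ p a) ∧ ∑ a : α, p a = 1

/-- The subsequence of `x` obtained by keeping exactly the positions in `S`. -/
def delOutput {n : ℕ} (x : Fin n → Bool) (S : Finset (Fin n)) : List Bool :=
  (S.sort (· ≤ ·)).map x

/-- Transition probability of the binary deletion channel `W_n^d`:
each bit is deleted independently with probability `d`. -/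
noncomputable def Wdel (n : ℕ) (d : ℝ) (x : Fin n → Bool) (y : List Bool) : ℝ :=
  ∑ S : Finset (Fin n),
    if delOutput x S = y then (1 - d) ^ S.card * d ^ (n - S.card) else 0

/-- `C_n(d)`: the supremum of `I(X;Y)` over input distributions on `{0,1}^n`,
where `Y` is the output of the deletion channel `W_n^d` on input `X`. -/
noncomputable def Cdel (n : ℕ) (d : ℝ) : ℝ :=
  sSup { r | ∃ p : (Fin n → Bool) → ℝ, IsDist p ∧
    r = MIc (fun x y => p x * Wdel n d x y) }

/-- Transition probability of the Poisson repeat channel with parameter `lam`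
and input length `n`: each bit `x i` is replaced by `k i` copies of itself,
where the `k i` are i.i.d. Poisson(`lam`), and the copies are concatenated. -/
noncomputable def Wprc (n : ℕ) (lam : ℝ) (x : Fin n → Bool) (y : List Bool) : ℝ :=
  ∑' k : Fin n → ℕ,
    (∏ i : Fin n, Real.exp (-lam) * lam ^ (k i) / (k i).factorial) *
      (if (List.ofFn (fun i => List.replicate (k i) (x i))).flatten = y then 1 else 0)

/-- `C_n^{PRC}(λ)`: the supremum of `I(X;Y)` over input distributions on
`{0,1}^n`, where `Y` is the output of the Poisson repeat channel on input `X`. -/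
noncomputable def Cprc (n : ℕ) (lam : ℝ) : ℝ :=
  sSup { r | ∃ p : (Fin n → Bool) → ℝ, IsDist p ∧
    r = MIc (fun x y => p x * Wprc n lam x y) }

open scoped ENNReal

/-- Expectation of `F` over the output of the deletion channel on the input string. -/
noncomputable def delExp (d : ℝ) : List Bool → (List Bool → ℝ≥0∞) → ℝ≥0∞
  | [], F => F []
  | b :: l, F =>
    ENNReal.ofReal d * delExp d l F + ENNReal.ofReal (1 - d) * delExp d l (fun z => F (b :: z))

/-- The Poisson probability mass function. -/
noncomputable def poi (μ : ℝ) (k : ℕ) : ℝ := Real.exp (-μ) * μ ^ k / k.factorial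

/-- Expectation of `F` over the output of the Poisson repeat channel on the input string. -/
noncomputable def prcExp (μ : ℝ) : List Bool → (List Bool → ℝ≥0∞) → ℝ≥0∞
  | [], F => F []
  | b :: l, F =>
    ∑' k, ENNReal.ofReal (poi μ k) * prcExp μ l (fun z => F (List.replicate k b ++ z))

/-- The string `x` with its `i`-th bit repeated `k i` times. -/
def repeatBits {n : ℕ} (x : Fin n → Bool) (k : Fin n → ℕ) : List Bool :=
  (List.ofFn (fun i => List.replicate (k i) (x i))).flatten

lemma poi_nonneg {μ : ℝ} (hμ : 0 ≤ μ) (k : ℕ) : 0 ≤ poi μ k := by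
  unfold poi; positivity

lemma poi_hasSum (μ : ℝ) : HasSum (poi μ) 1 := by
  have h := (NormedSpace.expSeries_div_hasSum_exp μ).mul_left (Real.exp (-μ))
  rw [← Real.exp_eq_exp_ℝ, ← Real.exp_add, neg_add_cancel, Real.exp_zero] at h
  simp only [← mul_div_assoc] at h
  exact h

lemma poi_tsum_ofReal {μ : ℝ} (hμ : 0 ≤ μ) : ∑' k, ENNReal.ofReal (poi μ k) = 1 := by
  rw [← ENNReal.ofReal_tsum_of_nonneg (poi_nonneg hμ) (poi_hasSum μ).summable,
    (poi_hasSum μ).tsum_eq, ENNReal.ofReal_one]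

lemma poi_mean {μ : ℝ} (hμ : 0 ≤ μ) :
    ∑' k, ENNReal.ofReal (poi μ k) * (k : ℝ≥0∞) = ENNReal.ofReal μ := by
  rw [tsum_eq_zero_add' (f := fun k : ℕ => ENNReal.ofReal (poi μ k) * (k : ℝ≥0∞)) ENNReal.summable]
  have h (k : ℕ) : ENNReal.ofReal (poi μ (k + 1)) * ((k + 1 : ℕ) : ℝ≥0∞)
      = ENNReal.ofReal μ * ENNReal.ofReal (poi μ k) := by
    rw [← ENNReal.ofReal_natCast, ← ENNReal.ofReal_mul (poi_nonneg hμ _),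
      ← ENNReal.ofReal_mul hμ]
    congr 1
    have : ((k : ℝ) + 1) ≠ 0 := by positivity
    simp only [poi, Nat.factorial_succ, Nat.cast_mul, Nat.cast_add, Nat.cast_one, pow_succ]
    field_simp
  simp_rw [h, ENNReal.tsum_mul_left, poi_tsum_ofReal hμ]
  simp

lemma delExp_append (d : ℝ) (l m : List Bool) (F : List Bool → ℝ≥0∞) :
    delExp d (l ++ m) F = delExp d l (fun u => delExp d m (fun z => F (u ++ z))) := by
  induction l generalizing F with
  | nil => rfl
  | cons b l ih => simp only [List.cons_append, delExp, ih]

lemma delExp_replicate (d : ℝ) (b : Bool) (k : ℕ) (F : List Bool → ℝ≥0∞) :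
    delExp d (List.replicate k b) F = ∑ ij ∈ antidiagonal k, k.choose ij.1 •
      (ENNReal.ofReal d ^ ij.1 * ENNReal.ofReal (1 - d) ^ ij.2 *
        F (List.replicate ij.2 b)) := by
  induction k generalizing F with
  | zero => simp [delExp]
  | succ k ih =>
    rw [Finset.sum_antidiagonal_choose_succ_nsmul (fun i j => ENNReal.ofReal d ^ i *
      ENNReal.ofReal (1 - d) ^ j * F (List.replicate j b))]
    rw [List.replicate_succ, delExp, ih, ih, Finset.mul_sum, Finset.mul_sum, add_comm]
    congr 1 <;> refine Finset.sum_congr rfl fun ij hij => ?_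
    · simp only [List.replicate_succ, nsmul_eq_mul]
      ring
    · rw [Nat.choose_symm_of_eq_add (HasAntidiagonal.mem_antidiagonal.1 hij).symm]
      simp only [nsmul_eq_mul]
      ring

lemma prcExp_sum (μ : ℝ) (l : List Bool) {ι : Type*} (s : Finset ι)
    (c : ι → ℝ≥0∞) (F : ι → List Bool → ℝ≥0∞) :
    prcExp μ l (fun z => ∑ i ∈ s, c i * F i z) = ∑ i ∈ s, c i * prcExp μ l (F i) := by
  induction l generalizing F with
  | nil => rfl
  | cons b l ih =>
    simp only [prcExp]
    simp_rw [ih (fun i z => F i (List.replicate _ b ++ z)), ← ENNReal.tsum_mul_left]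
    rw [← Summable.tsum_finsetSum (fun _ _ => ENNReal.summable)]
    refine tsum_congr fun k => ?_
    rw [Finset.mul_sum]
    exact Finset.sum_congr rfl fun i _ => by ring

lemma poi_thinning {d μ : ℝ} (hd₀ : 0 ≤ d) (hd₁ : d ≤ 1) (hμ : 0 ≤ μ) (G : ℕ → ℝ≥0∞) :
    ∑' k, ENNReal.ofReal (poi μ k) * ∑ ij ∈ antidiagonal k,
      (k.choose ij.1 : ℝ≥0∞) * (ENNReal.ofReal d ^ ij.1 * ENNReal.ofReal (1 - d) ^ ij.2) * G ij.2
    = ∑' j, ENNReal.ofReal (poi (μ * (1 - d)) j) * G j := by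
  have hq : 0 ≤ 1 - d := sub_nonneg.2 hd₁
  have key (i j : ℕ) : ENNReal.ofReal (poi μ (i + j)) *
      (((i + j).choose i : ℝ≥0∞) * (ENNReal.ofReal d ^ i * ENNReal.ofReal (1 - d) ^ j) * G j)
      = ENNReal.ofReal (poi (μ * d) i) * (ENNReal.ofReal (poi (μ * (1 - d)) j) * G j) := by
    rw [← mul_assoc, ← mul_assoc (ENNReal.ofReal (poi (μ * d) i))]
    congr 1
    rw [← ENNReal.ofReal_pow hd₀, ← ENNReal.ofReal_pow hq, ← ENNReal.ofReal_natCast,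
      ← ENNReal.ofReal_mul (pow_nonneg hd₀ _), ← ENNReal.ofReal_mul (Nat.cast_nonneg _),
      ← ENNReal.ofReal_mul (poi_nonneg hμ _), ← ENNReal.ofReal_mul (poi_nonneg (by positivity) _)]
    congr 1
    have he : Real.exp (-μ) = Real.exp (-(μ * d)) * Real.exp (-(μ * (1 - d))) := by
      rw [← Real.exp_add]; ring_nf
    have hc := Nat.add_choose_mul_factorial_mul_factorial i j
    rw [← Nat.choose_symm_add] at hc
    have hc' : ((i + j).choose i : ℝ) * i.factorial * j.factorial = (i + j).factorial := by
      exact_mod_cast hc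
    have h1 : ((i + j).factorial : ℝ) ≠ 0 := by positivity
    have h2 : (i.factorial : ℝ) ≠ 0 := by positivity
    have h3 : (j.factorial : ℝ) ≠ 0 := by positivity
    simp only [poi, he, mul_pow, pow_add]
    field_simp
    rw [← hc']
    ring
  calc _ = ∑' k, ∑ ij ∈ antidiagonal k, ENNReal.ofReal (poi (μ * d) ij.1) *
        (ENNReal.ofReal (poi (μ * (1 - d)) ij.2) * G ij.2) := by
        refine tsum_congr fun k => ?_
        rw [Finset.mul_sum]
        refine Finset.sum_congr rfl fun ij hij => ?_
        rw [← key, HasAntidiagonal.mem_antidiagonal.1 hij]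
    _ = ∑' p : ℕ × ℕ, ENNReal.ofReal (poi (μ * d) p.1) *
        (ENNReal.ofReal (poi (μ * (1 - d)) p.2) * G p.2) := by
        rw [← HasAntidiagonal.sigmaAntidiagonalEquivProd.tsum_eq, ENNReal.tsum_sigma']
        refine tsum_congr fun k => ?_
        rw [tsum_fintype, Finset.univ_eq_attach, ← Finset.sum_attach]
        rfl
    _ = _ := by
        rw [ENNReal.tsum_prod']
        simp_rw [ENNReal.tsum_mul_left, ENNReal.tsum_mul_right]
        rw [poi_tsum_ofReal (by positivity), one_mul]

/-- Repeating every bit Poisson(`μ`) times and then deleting with probability `d` is the same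
as repeating every bit Poisson(`μ * (1 - d)`) times. -/
lemma prcExp_delExp {d μ : ℝ} (hd₀ : 0 ≤ d) (hd₁ : d ≤ 1) (hμ : 0 ≤ μ) (l : List Bool)
    (F : List Bool → ℝ≥0∞) :
    prcExp μ l (fun z => delExp d z F) = prcExp (μ * (1 - d)) l F := by
  induction l generalizing F with
  | nil => rfl
  | cons b l ih =>
    simp only [prcExp]
    rw [← poi_thinning hd₀ hd₁ hμ]
    refine tsum_congr fun k => ?_
    congr 1
    simp_rw [delExp_append, delExp_replicate, nsmul_eq_mul, ← mul_assoc]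
    rw [prcExp_sum]
    simp_rw [ih]

lemma prcExp_length {μ : ℝ} (hμ : 0 ≤ μ) (l : List Bool) (A c : ℝ≥0∞) :
    prcExp μ l (fun z => A * z.length + c) = A * (ENNReal.ofReal μ * l.length) + c := by
  induction l generalizing c with
  | nil => simp [prcExp]
  | cons b l ih =>
    have h (k : ℕ) (z : List Bool) : A * ((List.replicate k b ++ z).length : ℝ≥0∞) + c
        = A * z.length + (A * k + c) := by
      rw [List.length_append, List.length_replicate]; push_cast; ring
    have h' (k : ℕ) : ENNReal.ofReal (poi μ k) *
        (A * (ENNReal.ofReal μ * l.length) + (A * k + c)) =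
        ENNReal.ofReal (poi μ k) * (A * (ENNReal.ofReal μ * l.length) + c) +
        A * (ENNReal.ofReal (poi μ k) * k) := by ring
    simp only [prcExp, h, ih, h']
    rw [ENNReal.tsum_add, ENNReal.tsum_mul_right, ENNReal.tsum_mul_left, poi_mean hμ,
      poi_tsum_ofReal hμ, List.length_cons]
    push_cast
    ring

lemma prcExp_ofFn {μ : ℝ} (hμ : 0 ≤ μ) {n : ℕ} (x : Fin n → Bool) (F : List Bool → ℝ≥0∞) :
    prcExp μ (List.ofFn x) F =
      ∑' k : Fin n → ℕ, ENNReal.ofReal (∏ i, poi μ (k i)) * F (repeatBits x k) := by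
  induction n generalizing F with
  | zero => simp [prcExp, repeatBits, tsum_fintype]
  | succ n ih =>
    rw [← (Fin.consEquiv (fun _ => ℕ)).tsum_eq, ENNReal.tsum_prod', List.ofFn_succ, prcExp]
    refine tsum_congr fun k => ?_
    rw [ih, ← ENNReal.tsum_mul_left]
    refine tsum_congr fun k' => ?_
    simp only [Fin.consEquiv_apply, Fin.prod_univ_succ, Fin.cons_zero, Fin.cons_succ, repeatBits,
      List.ofFn_succ, List.flatten_cons]
    rw [ENNReal.ofReal_mul (poi_nonneg hμ _), mul_assoc]

lemma length_repeatBits {n : ℕ} (x : Fin n → Bool) (k : Fin n → ℕ) :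
    (repeatBits x k).length = ∑ i, k i := by
  simp [repeatBits, List.length_flatten, List.map_ofFn, Function.comp_def, List.sum_ofFn]

lemma delOutput_image_succ {n : ℕ} (x : Fin (n + 1) → Bool) (S : Finset (Fin n)) :
    delOutput x (S.image Fin.succ) = delOutput (fun i => x i.succ) S := by
  have h : (S.image Fin.succ).sort (· ≤ ·) = (S.sort (· ≤ ·)).map Fin.succ := by
    refine List.Perm.eq_of_pairwise' (r := (· ≤ ·)) ?_
      (List.Pairwise.map _ ?_ (S.pairwise_sort (· ≤ ·))) ?_
    · exact (S.image Fin.succ).pairwise_sort (· ≤ ·)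
    · exact fun a b h => Fin.succ_le_succ_iff.2 h
    · rw [← Multiset.coe_eq_coe, Finset.sort_eq, ← Multiset.map_coe, Finset.sort_eq,
        Finset.image_val_of_injOn (Fin.succ_injective n).injOn]
  rw [delOutput, h, List.map_map]
  rfl

lemma delOutput_insert_zero {n : ℕ} (x : Fin (n + 1) → Bool) (S : Finset (Fin n)) :
    delOutput x (insert 0 (S.image Fin.succ)) = x 0 :: delOutput (fun i => x i.succ) S := by
  rw [← delOutput_image_succ, delOutput, Finset.sort_insert _ (fun _ _ => Fin.zero_le _) (by simp)]
  rfl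

lemma delExp_ofFn {d : ℝ} (hd₀ : 0 ≤ d) (hd₁ : d ≤ 1) {n : ℕ} (x : Fin n → Bool)
    (F : List Bool → ℝ≥0∞) :
    delExp d (List.ofFn x) F = ∑ S : Finset (Fin n),
      ENNReal.ofReal ((1 - d) ^ S.card * d ^ (n - S.card)) * F (delOutput x S) := by
  have hq : 0 ≤ 1 - d := sub_nonneg.2 hd₁
  induction n generalizing F with
  | zero =>
    rw [Fintype.sum_unique]
    simp [delExp, delOutput, Subsingleton.elim (default : Finset (Fin 0)) ∅]
  | succ n ih =>
    have hp : (univ : Finset (Finset (Fin (n + 1)))) =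
        (insert 0 (univ.image Fin.succ) : Finset (Fin (n + 1))).powerset := by
      rw [← Finset.powerset_univ]
      congr 1
      ext i
      cases i using Fin.cases <;> simp
    have hinj : Set.InjOn (fun S : Finset (Fin n) => S.image Fin.succ) 
        ((univ : Finset (Finset (Fin n))) : Set (Finset (Fin n))) :=
      (Finset.image_injective (Fin.succ_injective n)).injOn
    rw [hp, Finset.sum_powerset_insert (by simp), Finset.powerset_image, Finset.powerset_univ,
      Finset.sum_image hinj, Finset.sum_image hinj, List.ofFn_succ, delExp, ih, ih,
      Finset.mul_sum, Finset.mul_sum]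
    congr 1 <;> refine Finset.sum_congr rfl fun S _ => ?_
    · have hS : S.card ≤ n := by simpa using S.card_le_univ
      rw [delOutput_image_succ, Finset.card_image_of_injective _ (Fin.succ_injective n),
        ← mul_assoc, ← ENNReal.ofReal_mul hd₀, Nat.succ_sub hS, pow_succ]
      congr 2
      ring
    · rw [delOutput_insert_zero, Finset.card_insert_of_notMem (by simp),
        Finset.card_image_of_injective _ (Fin.succ_injective n),
        ← mul_assoc, ← ENNReal.ofReal_mul hq, Nat.add_sub_add_right, pow_succ]
      congr 2
      ring

/-- The pointwise contribution `a log (a / b) - a + b` to the relative entropy (in nats). -/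
noncomputable def klTerm (a b : ℝ) : ℝ := a * Real.log (a / b) - a + b

lemma klTerm_mul (c a b : ℝ) : klTerm (c * a) (c * b) = c * klTerm a b := by
  rcases eq_or_ne c 0 with rfl | hc
  · simp [klTerm]
  · rw [klTerm, mul_div_mul_left _ _ hc, klTerm]
    ring

lemma klTerm_zero_left (b : ℝ) : klTerm 0 b = b := by simp [klTerm]

/-- `klTerm` lies above its tangent plane at `(A, B)`. -/
lemma le_klTerm {a b A B : ℝ} (ha : 0 ≤ a) (hb : 0 ≤ b) (hab : b = 0 → a = 0)
    (hA : 0 < A) (hB : 0 < B) :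
    a * Real.log (A / B) + b * (1 - A / B) ≤ klTerm a b := by
  rcases ha.eq_or_lt with rfl | ha
  · rw [klTerm_zero_left, zero_mul, zero_add]
    have : 0 ≤ b * (A / B) := by positivity
    linarith
  · have hb : 0 < b := hb.lt_of_ne fun h => ha.ne' (hab h.symm)
    have h := Real.log_le_sub_one_of_pos (x := (A / B) / (a / b)) (by positivity)
    rw [Real.log_div (by positivity) (by positivity)] at h
    have h2 := mul_le_mul_of_nonneg_left h ha.le
    have h3 : a * ((A / B) / (a / b) - 1) = b * (A / B) - a := by field_simp
    rw [h3] at h2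
    rw [klTerm]
    linarith

lemma klTerm_nonneg {a b : ℝ} (ha : 0 ≤ a) (hb : 0 ≤ b) (hab : b = 0 → a = 0) :
    0 ≤ klTerm a b := by
  simpa using le_klTerm ha hb hab one_pos one_pos

lemma hasSum_of_tsum_ofReal {ι : Type*} {f : ι → ℝ} {A : ℝ} (hf : ∀ i, 0 ≤ f i) (hA : 0 ≤ A)
    (h : ∑' i, ENNReal.ofReal (f i) = ENNReal.ofReal A) : HasSum f A := by
  have hs : Summable f := by
    have := ENNReal.summable_toReal (f := fun i => ENNReal.ofReal (f i))
      (by rw [h]; exact ENNReal.ofReal_ne_top)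
    simpa [ENNReal.toReal_ofReal (hf _)] using this
  rw [← ENNReal.ofReal_tsum_of_nonneg hf hs,
    ENNReal.ofReal_eq_ofReal_iff (tsum_nonneg hf) hA] at h
  exact h ▸ hs.hasSum

/-- The log-sum inequality. -/
lemma klTerm_log_sum {ι : Type*} {P a b : ι → ℝ} {A B : ℝ} (hP : ∀ i, 0 ≤ P i)
    (ha : ∀ i, 0 ≤ a i) (hb : ∀ i, 0 ≤ b i) (hab : ∀ i, b i = 0 → a i = 0)
    (hA : HasSum (fun i => P i * a i) A) (hB : HasSum (fun i => P i * b i) B) :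
    ENNReal.ofReal (klTerm A B) ≤
      ∑' i, ENNReal.ofReal (P i) * ENNReal.ofReal (klTerm (a i) (b i)) := by
  simp_rw [← ENNReal.ofReal_mul (hP _)]
  have hnn (i : ι) : 0 ≤ P i * klTerm (a i) (b i) :=
    mul_nonneg (hP i) (klTerm_nonneg (ha i) (hb i) (hab i))
  by_cases htop : ∑' i, ENNReal.ofReal (P i * klTerm (a i) (b i)) = ∞
  · rw [htop]; exact le_top
  have hs : HasSum (fun i => P i * klTerm (a i) (b i)) _ := hasSum_of_tsum_ofReal hnn
    ENNReal.toReal_nonneg (ENNReal.ofReal_toReal htop).symm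
  rw [← ENNReal.ofReal_toReal htop]
  apply ENNReal.ofReal_le_ofReal
  have hPa (i : ι) : 0 ≤ P i * a i := mul_nonneg (hP i) (ha i)
  have hPb (i : ι) : 0 ≤ P i * b i := mul_nonneg (hP i) (hb i)
  rcases (hA.nonneg hPa).eq_or_lt with hA0 | hA0
  · rw [← hA0, klTerm_zero_left]
    rw [← hA0, hasSum_zero_iff_of_nonneg hPa] at hA
    refine hasSum_le (fun i => ?_) hB hs
    rw [← klTerm_mul, show P i * a i = 0 from congrFun hA i, klTerm_zero_left]
  have hB0 : 0 < B := by
    refine (hB.nonneg hPb).lt_of_ne fun h => hA0.ne' ?_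
    rw [← h, hasSum_zero_iff_of_nonneg hPb] at hB
    refine hA.unique ?_
    convert hasSum_zero using 2 with i
    rcases mul_eq_zero.1 (congrFun hB i) with h | h
    · rw [h, zero_mul]
    · rw [hab i h, mul_zero]
  have ht := (hA.mul_right (Real.log (A / B))).add (hB.mul_right (1 - A / B))
  have hk : klTerm A B = A * Real.log (A / B) + B * (1 - A / B) := by
    rw [klTerm]; field_simp; ring
  rw [hk]
  refine hasSum_le (fun i => ?_) ht hs
  have := mul_le_mul_of_nonneg_left (le_klTerm (ha i) (hb i) (hab i) hA0 hB0) (hP i)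
  linarith

/-- `W` is a channel: every row is a probability distribution. -/
def IsChannel {α : Type*} (W : α → List Bool → ℝ) : Prop :=
  (∀ x y, 0 ≤ W x y) ∧ ∀ x, HasSum (W x) 1

/-- Output distribution of the channel `W` on input distribution `p`. -/
noncomputable def outDist {α : Type*} [Fintype α] (p : α → ℝ) (W : α → List Bool → ℝ)
    (y : List Bool) : ℝ := ∑ x, p x * W x y

/-- Mutual information in nats, as an extended nonnegative real. -/
noncomputable def klInfo {α : Type*} [Fintype α] (p : α → ℝ) (W : α → List Bool → ℝ) : ℝ≥0∞ :=
  ∑ x, ∑' y, ENNReal.ofReal (klTerm (p x * W x y) (p x * outDist p W y))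

section Info

variable {α : Type*} [Fintype α] {p : α → ℝ} {W : α → List Bool → ℝ}

lemma outDist_nonneg (hp : IsDist p) (hW : IsChannel W) (y : List Bool) : 0 ≤ outDist p W y :=
  Finset.sum_nonneg fun x _ => mul_nonneg (hp.1 x) (hW.1 x y)

lemma outDist_hasSum (hp : IsDist p) (hW : IsChannel W) : HasSum (outDist p W) 1 := by
  have := hasSum_sum (s := univ) fun x _ => (hW.2 x).mul_left (p x)
  simp only [mul_one, hp.2] at this
  exact this

lemma mul_le_outDist (hp : IsDist p) (hW : IsChannel W) (x : α) (y : List Bool) :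
    p x * W x y ≤ outDist p W y :=
  Finset.single_le_sum (f := fun x => p x * W x y)
    (fun x _ => mul_nonneg (hp.1 x) (hW.1 x y)) (mem_univ x)

lemma mul_eq_zero_of_mul_outDist (hp : IsDist p) (hW : IsChannel W) (x : α) (y : List Bool)
    (h : p x * outDist p W y = 0) : p x * W x y = 0 := by
  rcases mul_eq_zero.1 h with h | h
  · rw [h, zero_mul]
  · exact le_antisymm (h ▸ mul_le_outDist hp hW x y) (mul_nonneg (hp.1 x) (hW.1 x y))

lemma klTerm_info_nonneg (hp : IsDist p) (hW : IsChannel W) (x : α) (y : List Bool) :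
    0 ≤ klTerm (p x * W x y) (p x * outDist p W y) :=
  klTerm_nonneg (mul_nonneg (hp.1 x) (hW.1 x y))
    (mul_nonneg (hp.1 x) (outDist_nonneg hp hW y)) (mul_eq_zero_of_mul_outDist hp hW x y)

lemma mul_log_le (hp : IsDist p) (hW : IsChannel W) (x : α) (y : List Bool) :
    p x * W x y * Real.log (p x * W x y / (p x * outDist p W y)) ≤ W x y := by
  rcases (mul_nonneg (hp.1 x) (hW.1 x y)).eq_or_lt with h | h
  · rw [← h, zero_mul]; exact hW.1 x y
  have hx : 0 < p x := (hp.1 x).lt_of_ne fun h' => by simp [← h'] at h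
  have hw : 0 < W x y := (pos_iff_pos_of_mul_pos h).1 hx
  have hq : 0 < outDist p W y := h.trans_le (mul_le_outDist hp hW x y)
  have h1 : p x * W x y / (p x * outDist p W y) ≤ 1 / p x := by
    rw [div_le_div_iff₀ (by positivity) hx]
    nlinarith [mul_le_outDist hp hW x y]
  have h2 : Real.log (p x * W x y / (p x * outDist p W y)) ≤ 1 / p x := by
    refine (Real.log_le_sub_one_of_pos (by positivity)).trans ?_
    linarith
  calc _ ≤ p x * W x y * (1 / p x) := mul_le_mul_of_nonneg_left h2 h.le
    _ = W x y := by field_simp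

lemma summable_klTerm_info (hp : IsDist p) (hW : IsChannel W) (x : α) :
    Summable fun y => klTerm (p x * W x y) (p x * outDist p W y) := by
  refine Summable.of_nonneg_of_le (klTerm_info_nonneg hp hW x) (fun y => ?_)
    ((hW.2 x).summable.add ((outDist_hasSum hp hW).summable.mul_left (p x)))
  rw [klTerm]
  linarith [mul_log_le hp hW x y, mul_nonneg (hp.1 x) (hW.1 x y)]

lemma hasSum_mul_log (hp : IsDist p) (hW : IsChannel W) (x : α) :
    HasSum (fun y => p x * W x y * Real.log (p x * W x y / (p x * outDist p W y)))
      (∑' y, klTerm (p x * W x y) (p x * outDist p W y)) := by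
  have h := ((summable_klTerm_info hp hW x).hasSum.add ((hW.2 x).mul_left (p x))).sub
    ((outDist_hasSum hp hW).mul_left (p x))
  rw [add_sub_cancel_right] at h
  have e (y : List Bool) : p x * W x y * Real.log (p x * W x y / (p x * outDist p W y)) =
      klTerm (p x * W x y) (p x * outDist p W y) + p x * W x y - p x * outDist p W y := by
    rw [klTerm]; ring
  rw [funext e]
  exact h

lemma MIc_eq (hp : IsDist p) (hW : IsChannel W) :
    MIc (fun x y => p x * W x y) =
      (∑ x, ∑' y, klTerm (p x * W x y) (p x * outDist p W y)) / Real.log 2 := by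
  rw [MIc, Finset.sum_div]
  refine Finset.sum_congr rfl fun x _ => ?_
  rw [((hW.2 x).mul_left (p x)).tsum_eq, mul_one, ← (hasSum_mul_log hp hW x).tsum_eq,
    ← tsum_div_const]
  refine tsum_congr fun y => ?_
  rw [Real.logb, ← mul_div_assoc (p x * W x y)]
  rfl

lemma MIc_nonneg (hp : IsDist p) (hW : IsChannel W) : 0 ≤ MIc (fun x y => p x * W x y) := by
  rw [MIc_eq hp hW]
  exact div_nonneg (Finset.sum_nonneg fun x _ => tsum_nonneg (klTerm_info_nonneg hp hW x))
    (Real.log_nonneg one_le_two)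

lemma MIc_le (hp : IsDist p) (hW : IsChannel W) :
    MIc (fun x y => p x * W x y) ≤ Fintype.card α / Real.log 2 := by
  rw [MIc_eq hp hW]
  refine div_le_div_of_nonneg_right ?_ (Real.log_nonneg one_le_two)
  calc _ ≤ ∑ _x : α, (1 : ℝ) := Finset.sum_le_sum fun x _ =>
        hasSum_le (mul_log_le hp hW x) (hasSum_mul_log hp hW x) (hW.2 x)
    _ = _ := by simp

lemma klInfo_eq (hp : IsDist p) (hW : IsChannel W) :
    klInfo p W = ENNReal.ofReal (Real.log 2 * MIc (fun x y => p x * W x y)) := by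
  rw [MIc_eq hp hW, mul_div_cancel₀ _ (Real.log_pos one_lt_two).ne',
    ENNReal.ofReal_sum_of_nonneg fun x _ => tsum_nonneg (klTerm_info_nonneg hp hW x)]
  exact Finset.sum_congr rfl fun x _ => (ENNReal.ofReal_tsum_of_nonneg
    (klTerm_info_nonneg hp hW x) (summable_klTerm_info hp hW x)).symm

/-- Mutual information is convex in the channel. -/
lemma klInfo_mixture_le {ι : Type*} {P : ι → ℝ} {V : ι → α → List Bool → ℝ} (hp : IsDist p)
    (hP : ∀ i, 0 ≤ P i) (hV : ∀ i, IsChannel (V i))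
    (hW : ∀ x y, HasSum (fun i => P i * V i x y) (W x y)) :
    klInfo p W ≤ ∑' i, ENNReal.ofReal (P i) * klInfo p (V i) := by
  have hQ (y : List Bool) : HasSum (fun i => P i * outDist p (V i) y) (outDist p W y) := by
    have := hasSum_sum (s := univ) fun x _ => (hW x y).mul_left (p x)
    have e (i : ι) : P i * outDist p (V i) y = ∑ x, p x * (P i * V i x y) := by
      rw [outDist, Finset.mul_sum]
      exact Finset.sum_congr rfl fun x _ => by ring
    rw [funext e]
    exact this
  have hterm (x : α) (y : List Bool) :
      ENNReal.ofReal (klTerm (p x * W x y) (p x * outDist p W y)) ≤ ∑' i, ENNReal.ofReal (P i) *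
        ENNReal.ofReal (klTerm (p x * V i x y) (p x * outDist p (V i) y)) := by
    refine klTerm_log_sum hP (fun i => mul_nonneg (hp.1 x) ((hV i).1 x y))
      (fun i => mul_nonneg (hp.1 x) (outDist_nonneg hp (hV i) y))
      (fun i => mul_eq_zero_of_mul_outDist hp (hV i) x y) ?_ ?_
    · simpa only [mul_left_comm] using (hW x y).mul_left (p x)
    · simpa only [mul_left_comm] using (hQ y).mul_left (p x)
  calc klInfo p W ≤ ∑ x, ∑' y, ∑' i, ENNReal.ofReal (P i) *
        ENNReal.ofReal (klTerm (p x * V i x y) (p x * outDist p (V i) y)) :=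
        Finset.sum_le_sum fun x _ => ENNReal.tsum_le_tsum (hterm x)
    _ = _ := by
        simp_rw [klInfo, Finset.mul_sum, ← ENNReal.tsum_mul_left]
        rw [Summable.tsum_finsetSum fun _ _ => ENNReal.summable]
        exact Finset.sum_congr rfl fun x _ => ENNReal.tsum_comm

/-- Push-forward of `p` along `r`. -/
noncomputable def pushDist {β : Type*} [DecidableEq β] (p : α → ℝ) (r : α → β) (b : β) : ℝ :=
  ∑ x with r x = b, p x

variable {β : Type*} [Fintype β] [DecidableEq β]

lemma sum_pushDist_mul (r : α → β) (f : β → ℝ) :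
    ∑ b, pushDist p r b * f b = ∑ x, p x * f (r x) := by
  rw [← Finset.sum_fiberwise univ r (fun x => p x * f (r x))]
  refine Finset.sum_congr rfl fun b _ => ?_
  rw [pushDist, Finset.sum_mul]
  refine Finset.sum_congr rfl fun x hx => ?_
  rw [(Finset.mem_filter.1 hx).2]

lemma pushDist_isDist (hp : IsDist p) (r : α → β) : IsDist (pushDist p r) :=
  ⟨fun _ => Finset.sum_nonneg fun x _ => hp.1 x, by
    simpa [hp.2] using sum_pushDist_mul (p := p) r (fun _ => 1)⟩

lemma klInfo_pushDist (hp : IsDist p) (r : α → β) {V : β → List Bool → ℝ} :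
    klInfo (pushDist p r) V = klInfo p (fun x => V (r x)) := by
  have hQ : outDist (pushDist p r) V = outDist p (fun x => V (r x)) :=
    funext fun y => sum_pushDist_mul r fun b => V b y
  simp_rw [klInfo, hQ, klTerm_mul]
  rw [← Finset.sum_fiberwise univ r]
  refine Finset.sum_congr rfl fun b _ => ?_
  simp_rw [ENNReal.ofReal_mul ((pushDist_isDist hp r).1 b), ENNReal.ofReal_mul (hp.1 _),
    ENNReal.tsum_mul_left]
  rw [pushDist, ENNReal.ofReal_sum_of_nonneg fun x _ => hp.1 x, Finset.sum_mul]
  refine Finset.sum_congr rfl fun x hx => ?_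
  rw [(Finset.mem_filter.1 hx).2]

end Info

lemma ofReal_Wdel {d : ℝ} (hd₀ : 0 ≤ d) (hd₁ : d ≤ 1) {n : ℕ} (x : Fin n → Bool)
    (y : List Bool) :
    ENNReal.ofReal (Wdel n d x y) = delExp d (List.ofFn x) (fun z => if z = y then 1 else 0) := by
  have hq : 0 ≤ 1 - d := sub_nonneg.2 hd₁
  rw [delExp_ofFn hd₀ hd₁, Wdel, ENNReal.ofReal_sum_of_nonneg fun S _ => by positivity]
  refine Finset.sum_congr rfl fun S _ => ?_
  split_ifs <;> simp

lemma isChannel_Wdel {d : ℝ} (hd₀ : 0 ≤ d) (hd₁ : d ≤ 1) (n : ℕ) : IsChannel (Wdel n d) := by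
  have hq : 0 ≤ 1 - d := sub_nonneg.2 hd₁
  refine ⟨fun x y => Finset.sum_nonneg fun S _ => by positivity, fun x => ?_⟩
  have h := hasSum_sum (s := (univ : Finset (Finset (Fin n)))) fun S _ =>
    hasSum_ite_eq (delOutput x S) ((1 - d) ^ S.card * d ^ (n - S.card))
  rw [Fin.sum_pow_mul_eq_add_pow, sub_add_cancel, one_pow] at h
  have e (y : List Bool) : Wdel n d x y = ∑ S : Finset (Fin n),
      if y = delOutput x S then (1 - d) ^ S.card * d ^ (n - S.card) else 0 := by
    simp only [Wdel, eq_comm]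
  rw [funext e]
  exact h

lemma tsum_ofReal_prod_poi {μ : ℝ} (hμ : 0 ≤ μ) (n : ℕ) :
    ∑' k : Fin n → ℕ, ENNReal.ofReal (∏ i, poi μ (k i)) = 1 := by
  have h := prcExp_length hμ (List.ofFn fun _ : Fin n => false) 0 1
  rw [prcExp_ofFn hμ] at h
  simpa using h

lemma prod_poi_nonneg {μ : ℝ} (hμ : 0 ≤ μ) {n : ℕ} (k : Fin n → ℕ) : 0 ≤ ∏ i, poi μ (k i) :=
  Finset.prod_nonneg fun i _ => poi_nonneg hμ (k i)

lemma ofReal_Wprc {μ : ℝ} (hμ : 0 ≤ μ) {n : ℕ} (x : Fin n → Bool) (y : List Bool) :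
    ENNReal.ofReal (Wprc n μ x y) = prcExp μ (List.ofFn x) (fun z => if z = y then 1 else 0) := by
  have hP : HasSum (fun k : Fin n → ℕ => ∏ i, poi μ (k i)) 1 :=
    hasSum_of_tsum_ofReal (prod_poi_nonneg hμ) zero_le_one
      (by rw [tsum_ofReal_prod_poi hμ, ENNReal.ofReal_one])
  have hnn (k : Fin n → ℕ) :
      0 ≤ (∏ i, poi μ (k i)) * (if repeatBits x k = y then (1 : ℝ) else 0) :=
    mul_nonneg (prod_poi_nonneg hμ k) (by positivity)
  have hs : Summable fun k : Fin n → ℕ =>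
      (∏ i, poi μ (k i)) * (if repeatBits x k = y then (1 : ℝ) else 0) :=
    Summable.of_nonneg_of_le hnn
      (fun k => mul_le_of_le_one_right (prod_poi_nonneg hμ k) (by split_ifs <;> simp)) hP.summable
  rw [prcExp_ofFn hμ]
  refine (ENNReal.ofReal_tsum_of_nonneg hnn hs).trans (tsum_congr fun k => ?_)
  rw [ENNReal.ofReal_mul (prod_poi_nonneg hμ k)]
  split_ifs <;> simp

lemma Wprc_nonneg {μ : ℝ} (hμ : 0 ≤ μ) {n : ℕ} (x : Fin n → Bool) (y : List Bool) :
    0 ≤ Wprc n μ x y :=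
  tsum_nonneg fun k => mul_nonneg (prod_poi_nonneg hμ k) (by positivity)

lemma isChannel_Wprc {μ : ℝ} (hμ : 0 ≤ μ) (n : ℕ) : IsChannel (Wprc n μ) := by
  refine ⟨Wprc_nonneg hμ, fun x => hasSum_of_tsum_ofReal (Wprc_nonneg hμ x) zero_le_one ?_⟩
  simp_rw [ofReal_Wprc hμ, prcExp_ofFn hμ]
  rw [ENNReal.tsum_comm]
  simp_rw [ENNReal.tsum_mul_left, eq_comm (a := repeatBits x _), tsum_ite_eq, mul_one]
  rw [tsum_ofReal_prod_poi hμ, ENNReal.ofReal_one]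

/-- The encoder repeating bit `i` exactly `k i` times, as a map between strings of fixed length. -/
def repeatEnc {n : ℕ} (k : Fin n → ℕ) (x : Fin n → Bool) : Fin (∑ i, k i) → Bool :=
  fun i => (repeatBits x k).getD i false

lemma ofFn_repeatEnc {n : ℕ} (k : Fin n → ℕ) (x : Fin n → Bool) :
    List.ofFn (repeatEnc k x) = repeatBits x k := by
  refine List.ext_getElem (by simp [length_repeatBits]) fun i h₁ h₂ => ?_
  simp [repeatEnc, h₂]

/-- The Poisson repeat channel is a mixture of deletion channels preceded by random repetition. -/
lemma hasSum_Wdel_repeatEnc {d μ : ℝ} (hd₀ : 0 ≤ d) (hd₁ : d ≤ 1) (hμ : 0 ≤ μ) {n : ℕ}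
    (x : Fin n → Bool) (y : List Bool) :
    HasSum (fun k : Fin n → ℕ => (∏ i, poi μ (k i)) * Wdel _ d (repeatEnc k x) y)
      (Wprc n (μ * (1 - d)) x y) := by
  have hq : 0 ≤ μ * (1 - d) := mul_nonneg hμ (sub_nonneg.2 hd₁)
  refine hasSum_of_tsum_ofReal (fun k => mul_nonneg (prod_poi_nonneg hμ k)
    ((isChannel_Wdel hd₀ hd₁ _).1 _ y)) (Wprc_nonneg hq x y) ?_
  rw [ofReal_Wprc hq, ← prcExp_delExp hd₀ hd₁ hμ, prcExp_ofFn hμ]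
  refine tsum_congr fun k => ?_
  rw [ENNReal.ofReal_mul (prod_poi_nonneg hμ k), ofReal_Wdel hd₀ hd₁, ofFn_repeatEnc]

lemma MIc_le_Cdel {d : ℝ} (hd₀ : 0 ≤ d) (hd₁ : d ≤ 1) {n : ℕ} {p : (Fin n → Bool) → ℝ}
    (hp : IsDist p) : MIc (fun x y => p x * Wdel n d x y) ≤ Cdel n d := by
  refine le_csSup ⟨Fintype.card (Fin n → Bool) / Real.log 2, ?_⟩ ⟨p, hp, rfl⟩
  rintro _ ⟨p', hp', rfl⟩
  exact MIc_le hp' (isChannel_Wdel hd₀ hd₁ n)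

lemma Cdel_nonneg {d : ℝ} (hd₀ : 0 ≤ d) (hd₁ : d ≤ 1) (n : ℕ) : 0 ≤ Cdel n d := by
  refine Real.sSup_nonneg ?_
  rintro _ ⟨p, hp, rfl⟩
  exact MIc_nonneg hp (isChannel_Wdel hd₀ hd₁ n)

lemma tsum_prod_poi_affine {μ : ℝ} (hμ : 0 ≤ μ) (n : ℕ) (A c : ℝ≥0∞) :
    ∑' k : Fin n → ℕ, ENNReal.ofReal (∏ i, poi μ (k i)) * (A * (∑ i, k i : ℕ) + c) =
      A * (ENNReal.ofReal μ * n) + c := by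
  have h := prcExp_length hμ (List.ofFn fun _ : Fin n => false) A c
  simpa only [prcExp_ofFn hμ, length_repeatBits, List.length_ofFn] using h

lemma Cprc_le_of_Cdel_le {d μ A K : ℝ} (hd₀ : 0 ≤ d) (hd₁ : d ≤ 1) (hμ : 0 ≤ μ) (hA : 0 ≤ A)
    (hK : 0 ≤ K) (hC : ∀ n : ℕ, Cdel n d ≤ A * n + K) (n : ℕ) :
    Cprc n (μ * (1 - d)) ≤ A * (μ * n) + K := by
  have hq : 0 ≤ μ * (1 - d) := mul_nonneg hμ (sub_nonneg.2 hd₁)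
  refine Real.sSup_le ?_ (by positivity)
  rintro _ ⟨p, hp, rfl⟩
  have hV (k : Fin n → ℕ) : IsChannel fun x => Wdel (∑ i, k i) d (repeatEnc k x) :=
    ⟨fun x => (isChannel_Wdel hd₀ hd₁ _).1 _, fun x => (isChannel_Wdel hd₀ hd₁ _).2 _⟩
  have hlog : 0 < Real.log 2 := Real.log_pos one_lt_two
  have hk (k : Fin n → ℕ) : klInfo p (fun x => Wdel (∑ i, k i) d (repeatEnc k x)) ≤
      ENNReal.ofReal (Real.log 2) * (ENNReal.ofReal A * (∑ i, k i : ℕ) + ENNReal.ofReal K) := by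
    have hp' := pushDist_isDist hp (repeatEnc k)
    rw [← klInfo_pushDist hp (repeatEnc k), klInfo_eq hp' (isChannel_Wdel hd₀ hd₁ _),
      ENNReal.ofReal_mul hlog.le, ← ENNReal.ofReal_natCast, ← ENNReal.ofReal_mul hA,
      ← ENNReal.ofReal_add (by positivity) hK]
    gcongr
    exact (MIc_le_Cdel hd₀ hd₁ hp').trans (hC _)
  have h := (klInfo_mixture_le hp (prod_poi_nonneg hμ) hV
    (hasSum_Wdel_repeatEnc hd₀ hd₁ hμ)).trans
    (ENNReal.tsum_le_tsum fun k => mul_le_mul_right (hk k) _)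
  simp_rw [mul_left_comm _ (ENNReal.ofReal (Real.log 2))] at h
  rw [ENNReal.tsum_mul_left, tsum_prod_poi_affine hμ, klInfo_eq hp (isChannel_Wprc hq n),
    ← ENNReal.ofReal_natCast, ← ENNReal.ofReal_mul hμ, ← ENNReal.ofReal_mul hA,
    ← ENNReal.ofReal_add (by positivity) hK, ← ENNReal.ofReal_mul hlog.le,
    ENNReal.ofReal_le_ofReal_iff (by positivity)] at h
  exact le_of_mul_le_mul_left h hlog

lemma exists_affine_bound {u : ℕ → ℝ} {L A : ℝ} (hu : ∀ n, 0 ≤ u n)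
    (h : Filter.Tendsto (fun n : ℕ => u n / n) Filter.atTop (nhds L)) (hLA : L < A)
    (hA : 0 ≤ A) : ∃ K, 0 ≤ K ∧ ∀ n : ℕ, u n ≤ A * n + K := by
  obtain ⟨N, hN⟩ := Filter.eventually_atTop.1 ((h.eventually_lt_const hLA).and
    (Filter.eventually_gt_atTop 0))
  refine ⟨∑ i ∈ range N, u i, Finset.sum_nonneg fun i _ => hu i, fun n => ?_⟩
  rcases lt_or_ge n N with hn | hn
  · have h₁ := Finset.single_le_sum (fun i _ => hu i) (Finset.mem_range.2 hn)
    have h₂ : 0 ≤ A * n := by positivity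
    linarith
  · obtain ⟨h₁, h₂⟩ := hN n hn
    rw [div_lt_iff₀ (by exact_mod_cast h₂)] at h₁
    have h₃ := Finset.sum_nonneg (s := range N) fun i _ => hu i
    linarith

/-- For every `d ∈ (0,1)` and `λ > 0`,
`C(BDC_d) ≥ ((1−d)/λ) · C(PRC_λ)`: for all reals `L`, `L_P`, if `C_n(d)/n → L`
and `C_n^{PRC}(λ)/n → L_P` as `n → ∞`, then `L ≥ ((1−d)/λ) · L_P`. -/
theorem bdc_ge_prc (d lam : ℝ) (hd₀ : 0 < d) (hd₁ : d < 1) (hlam : 0 < lam)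
    (L LP : ℝ)
    (hL : Filter.Tendsto (fun n : ℕ => Cdel n d / n) Filter.atTop (nhds L))
    (hLP : Filter.Tendsto (fun n : ℕ => Cprc n lam / n) Filter.atTop (nhds LP)) :
    L ≥ ((1 - d) / lam) * LP := by
  have hq : 0 < 1 - d := sub_pos.2 hd₁
  set μ := lam / (1 - d) with hμ
  have hμ₀ : 0 < μ := by positivity
  have hlam' : μ * (1 - d) = lam := div_mul_cancel₀ _ hq.ne'
  have hC := Cdel_nonneg hd₀.le hd₁.le
  have hL₀ : 0 ≤ L := ge_of_tendsto' hL fun n => div_nonneg (hC n) n.cast_nonneg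
  have key (A : ℝ) (hA : L < A) : LP ≤ A * μ := by
    have hA₀ : 0 ≤ A := hL₀.trans hA.le
    obtain ⟨K, hK, hCK⟩ := exists_affine_bound hC hL hA hA₀
    have hlim : Filter.Tendsto (fun n : ℕ => A * μ + K / n) Filter.atTop (nhds (A * μ)) := by
      simpa using (tendsto_const_div_atTop_nhds_zero_nat K).const_add (A * μ)
    refine le_of_tendsto_of_tendsto hLP hlim ?_
    filter_upwards [Filter.eventually_gt_atTop 0] with n hn
    have hn' : (0 : ℝ) < n := by exact_mod_cast hn
    have h := Cprc_le_of_Cdel_le hd₀.le hd₁.le hμ₀.le hA₀ hK hCK n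
    rw [hlam'] at h
    rw [div_le_iff₀ hn', add_mul, div_mul_cancel₀ _ hn'.ne']
    linarith
  have hLP' : LP / μ ≤ L := le_of_forall_gt_imp_ge_of_dense fun A hA =>
    (div_le_iff₀ hμ₀).2 (key A hA)
  calc (1 - d) / lam * LP = LP / μ := by rw [hμ]; field_simp
    _ ≤ L := hLP'
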